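/- arXiv:2112.14064 — 2 statements merged into one kernel-verified Lean document; each statement's English description precedes it below -/
import Mathlib

section
/- Let K, C, M be N×N complex matrices, s ∈ ℂ, and suppose Q(s) = K + s·C + s²·M is invertible. Let L(s) := fromBlocks (−s·I) I (−K) (−C − s·M) and B := fromBlocks I 0 0 M be the 2N×2N linearized pencil and mass matrix. For v_u, v_l ∈ ℂ^N, define r_u := −Q(s)⁻¹(s·M·v_u + C·v_u + M·v_l) and r_l := s·r_u + v_u. Then L(s) applied to the block vector (r_u, r_l) equals B applied to (v_u, v_l); that is, (r_u, r_l) = L(s)⁻¹·B·(v_u, v_l). Hence the operator-times-vector step of the Arnoldi recurrence for the linearized quadratic eigenproblem can be computed using only N×N matrices. -/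
open Matrix

/-- The linearized pencil acting on a block vector, in terms of the quadratic pencil. -/
theorem linearized_pencil_mulVec {n R : Type*} [Fintype n] [DecidableEq n] [CommRing R]
    (K C M : Matrix n n R) (s : R) (a b : n → R) :
    Matrix.fromBlocks (-(s • 1)) 1 (-K) (-C - s • M) *ᵥ Sum.elim a b =
      Sum.elim (b - s • a)
        (-((K + s • C + s ^ 2 • M) *ᵥ a) - (C + s • M) *ᵥ (b - s • a)) := by
  rw [Matrix.fromBlocks_mulVec]
  simp only [Sum.elim_comp_inl, Sum.elim_comp_inr]
  congr 1
  · simp only [Matrix.neg_mulVec, Matrix.smul_mulVec, Matrix.one_mulVec]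
    abel
  · simp only [Matrix.neg_mulVec, Matrix.sub_mulVec, Matrix.add_mulVec, Matrix.smul_mulVec,
      Matrix.mulVec_sub, Matrix.mulVec_smul]
    module

/-- The linearized pencil is invertible wherever the quadratic pencil is. -/
theorem isUnit_linearized_pencil {n F : Type*} [Fintype n] [DecidableEq n] [Field F]
    (K C M : Matrix n n F) (s : F) (hQ : IsUnit (K + s • C + s ^ 2 • M)) :
    IsUnit (Matrix.fromBlocks (-(s • (1 : Matrix n n F))) 1 (-K) (-C - s • M)) := by
  rw [← Matrix.mulVec_injective_iff_isUnit]
  refine (injective_iff_map_eq_zero (Matrix.mulVecLin _)).2 fun x hx => ?_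
  rw [Matrix.mulVecLin_apply, ← Sum.elim_comp_inl_inr x, linearized_pencil_mulVec] at hx
  have hu : x ∘ Sum.inr - s • (x ∘ Sum.inl) = 0 := funext fun i => congrFun hx (Sum.inl i)
  have hl : -((K + s • C + s ^ 2 • M) *ᵥ (x ∘ Sum.inl)) = 0 := by
    funext i
    simpa [hu] using congrFun hx (Sum.inr i)
  have ha : x ∘ Sum.inl = 0 :=
    Matrix.mulVec_injective_of_isUnit hQ (by rw [neg_eq_zero.1 hl, Matrix.mulVec_zero])
  have hb : x ∘ Sum.inr = 0 := by simpa [ha] using hu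
  rw [← Sum.elim_comp_inl_inr x, ha, hb, Sum.elim_zero_zero]

/-- The operator-times-vector step of the Arnoldi recurrence for the linearized
quadratic eigenproblem can be computed with `N×N` matrices: with
`r_u = -Q(s)⁻¹(s M v_u + C v_u + M v_l)` and `r_l = s r_u + v_u`, one has
`L(s) (r_u, r_l) = B (v_u, v_l)`, i.e. `(r_u, r_l) = L(s)⁻¹ B (v_u, v_l)`. -/
theorem linearized_operator_apply_block
    (N : ℕ) (K C M : Matrix (Fin N) (Fin N) ℂ) (s : ℂ)
    (hQ : IsUnit (K + s • C + s ^ 2 • M))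
    (L B : Matrix (Fin N ⊕ Fin N) (Fin N ⊕ Fin N) ℂ)
    (hL : L = Matrix.fromBlocks (-(s • 1)) 1 (-K) (-C - s • M))
    (hB : B = Matrix.fromBlocks 1 0 0 M)
    (vu vl ru rl : Fin N → ℂ)
    (hru : ru = -((K + s • C + s ^ 2 • M)⁻¹.mulVec
        (s • M.mulVec vu + C.mulVec vu + M.mulVec vl)))
    (hrl : rl = s • ru + vu) :
    L.mulVec (Sum.elim ru rl) = B.mulVec (Sum.elim vu vl) ∧
      Sum.elim ru rl = L⁻¹.mulVec (B.mulVec (Sum.elim vu vl)) := by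
  have hdet := (Matrix.isUnit_iff_isUnit_det _).1 hQ
  have happly : L.mulVec (Sum.elim ru rl) = B.mulVec (Sum.elim vu vl) := by
    have hsub : rl - s • ru = vu := by rw [hrl, add_sub_cancel_left]
    have hres : -((K + s • C + s ^ 2 • M) *ᵥ ru) =
        s • M.mulVec vu + C.mulVec vu + M.mulVec vl := by
      rw [hru, Matrix.mulVec_neg, neg_neg, Matrix.mulVec_mulVec, Matrix.mul_nonsing_inv _ hdet,
        Matrix.one_mulVec]
    rw [hL, hB, linearized_pencil_mulVec, hsub, hres, Matrix.fromBlocks_mulVec]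
    simp only [Sum.elim_comp_inl, Sum.elim_comp_inr, Matrix.one_mulVec, Matrix.zero_mulVec,
      add_zero, zero_add]
    congr 1
    rw [Matrix.add_mulVec, Matrix.smul_mulVec]
    abel
  refine ⟨happly, ?_⟩
  have hLdet : IsUnit L.det :=
    (Matrix.isUnit_iff_isUnit_det _).1 (hL ▸ isUnit_linearized_pencil K C M s hQ)
  rw [← happly, Matrix.mulVec_mulVec, Matrix.nonsing_inv_mul _ hLdet, Matrix.one_mulVec]
end

section
/- Let K, C, M be N×N complex matrices, s ∈ ℂ, and suppose Q(s) = K + s·C + s²·M is invertible. Let L(s) := fromBlocks (−s·I) I (−K) (−C − s·M) and B := fromBlocks I 0 0 M. Then L(s) · (fromBlocks Q(s)⁻¹ 0 0 Q(s)⁻¹ · fromBlocks (−C − s·M) (−M) K (−s·M)) = B; that is, the shift-and-invert operator of the linearized quadratic eigenproblem admits the block factorization S = L(s)⁻¹·B = fromBlocks Q(s)⁻¹ 0 0 Q(s)⁻¹ · fromBlocks (−C − s·M) (−M) K (−s·M), involving only N×N blocks. -/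
open Matrix

/-- Block factorization of the shift-and-invert operator of the linearized quadratic
eigenproblem: `L(s) · (diag(Q(s)⁻¹, Q(s)⁻¹) · fromBlocks (-C - sM) (-M) K (-sM)) = B`,
so `S = L(s)⁻¹ B` involves only `N×N` blocks. -/
theorem linearized_operator_block_factorization
    (N : ℕ) (K C M : Matrix (Fin N) (Fin N) ℂ) (s : ℂ)
    (hQ : IsUnit (K + s • C + s ^ 2 • M))
    (L B : Matrix (Fin N ⊕ Fin N) (Fin N ⊕ Fin N) ℂ)
    (hL : L = Matrix.fromBlocks (-(s • 1)) 1 (-K) (-C - s • M))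
    (hB : B = Matrix.fromBlocks 1 0 0 M) :
    L * (Matrix.fromBlocks (K + s • C + s ^ 2 • M)⁻¹ 0 0 (K + s • C + s ^ 2 • M)⁻¹ *
        Matrix.fromBlocks (-C - s • M) (-M) K (-(s • M))) = B := by
  have hdet := (Matrix.isUnit_iff_isUnit_det _).mp hQ
  have hr := Matrix.mul_nonsing_inv _ hdet
  have hl := Matrix.nonsing_inv_mul _ hdet
  generalize (K + s • C + s ^ 2 • M)⁻¹ = P at hr hl ⊢
  obtain ⟨D, hD⟩ : ∃ D, D = C + s • M := ⟨_, rfl⟩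
  have hQD : K + s • C + s ^ 2 • M = K + s • D := by
    rw [hD, smul_add, smul_smul, ← sq, add_assoc]
  have hCD : -C - s • M = -D := by rw [hD, neg_add, sub_eq_add_neg]
  rw [hQD, add_mul, smul_mul_assoc] at hr
  rw [hQD, mul_add, mul_smul_comm] at hl
  have hKP : K * P = 1 - s • (D * P) := eq_sub_of_add_eq hr
  have hPK : P * K = 1 - s • (P * D) := eq_sub_of_add_eq hl
  have hKPX (X : Matrix (Fin N) (Fin N) ℂ) : K * (P * X) = X - s • (D * (P * X)) := by
    rw [← Matrix.mul_assoc, hKP, Matrix.sub_mul, Matrix.one_mul, Matrix.smul_mul,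
      Matrix.mul_assoc]
  rw [hL, hB, hCD, Matrix.fromBlocks_multiply, Matrix.fromBlocks_multiply]
  simp only [Matrix.zero_mul, add_zero, zero_add, Matrix.neg_mul, Matrix.mul_neg,
    Matrix.one_mul, Matrix.smul_mul, Matrix.mul_smul, hPK, hKPX, Matrix.mul_sub,
    Matrix.mul_one, smul_neg, neg_neg, smul_zero, neg_zero]
  congr 1 <;> abel
end
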